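/- Let q ≥ 2, n ≥ 0, g ≥ 0, l ≥ 0 and M ≥ l+1 be integers. The number of functions E : Fin M → (Fin q)^n for which there exist a word z ∈ (Fin q)^{n+g} and l+1 distinct messages m₁, …, m_{l+1} ∈ Fin M such that each of E(m₁), …, E(m_{l+1}) is a subsequence of z, is at most q^{n+g} · M^{l+1} · ((n+g) choose n)^{l+1} · q^{n·(M−l−1)}. Equivalently, for a uniformly random such E, the probability of this event is at most q^{n+g} · M^{l+1} · ( (n+g choose n) / q^n )^{l+1}. -/

import Mathlib

/-- A list of length `N` has at most `N.choose n` distinct subsequences of length `n`. -/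
theorem card_filter_ofFn_sublist_le {α : Type*} [Fintype α] [DecidableEq α] (n : ℕ) (z : List α) :
    (Finset.univ.filter fun v : Fin n → α => (List.ofFn v).Sublist z).card ≤
      z.length.choose n := by
  calc
    _ ≤ (List.sublistsLen n z).toFinset.card := by
      refine Finset.card_le_card_of_injOn List.ofFn (fun v hv => ?_) List.ofFn_injective.injOn
      simpa [List.mem_sublistsLen] using hv
    _ ≤ (List.sublistsLen n z).length := List.toFinset_card_le _
    _ = z.length.choose n := List.length_sublistsLen n z

/-- The number of functions which send the values of an injective family into a given set. -/
theorem card_filter_forall_apply_mem {κ ι α : Type*} [Fintype κ] [Fintype ι] [DecidableEq ι]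
    [Fintype α] [DecidableEq α] (s : Finset α) {f : κ → ι} (hf : Function.Injective f) :
    (Finset.univ.filter fun E : ι → α => ∀ i, E (f i) ∈ s).card =
      s.card ^ Fintype.card κ * Fintype.card α ^ (Fintype.card ι - Fintype.card κ) := by
  have hset : (Finset.univ.filter fun E : ι → α => ∀ i, E (f i) ∈ s) =
      Fintype.piFinset fun m => if m ∈ Finset.univ.image f then s else Finset.univ := by
    ext E
    simp only [Finset.mem_filter_univ, Fintype.mem_piFinset]
    constructor
    · intro h m
      split_ifs with hm
      · obtain ⟨i, -, rfl⟩ := Finset.mem_image.mp hm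
        exact h i
      · exact Finset.mem_univ _
    · intro h i
      simpa using h (f i)
  have hcard : (Finset.univ.image f).card = Fintype.card κ :=
    Finset.card_image_of_injective _ hf
  rw [hset, Fintype.card_piFinset]
  simp_rw [apply_ite Finset.card]
  rw [Finset.prod_ite, Finset.prod_const, Finset.prod_const, Finset.filter_mem_eq_inter,
    Finset.univ_inter, hcard, Finset.filter_notMem_eq_sdiff,
    Finset.card_sdiff_of_subset (Finset.subset_univ _), hcard, Finset.card_univ, Finset.card_univ]


open Classical in
/-- Exact union-bound inequality underlying the paper's Theorem 7. For integers
`q ≥ 2`, `n, g, l ≥ 0` and `M ≥ l+1`, the number of functions `E : Fin M → (Fin q)^n`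
for which some word `z ∈ (Fin q)^{n+g}` contains `l+1` distinct codewords as
subsequences is at most `q^{n+g} · M^{l+1} · ((n+g) choose n)^{l+1} · q^{n(M−l−1)}`. -/
theorem stmt_19 (q n g l M : ℕ) (hq : 2 ≤ q) (hM : l + 1 ≤ M) :
    ((Finset.univ : Finset (Fin M → (Fin n → Fin q))).filter
        (fun E => ∃ z : Fin (n + g) → Fin q,
          ∃ f : Fin (l + 1) → Fin M, Function.Injective f ∧
            ∀ i, (List.ofFn (E (f i))).Sublist (List.ofFn z))).card ≤
      q ^ (n + g) * M ^ (l + 1) * (Nat.choose (n + g) n) ^ (l + 1) *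
        q ^ (n * (M - (l + 1))) := by
  let A (p : (Fin (n + g) → Fin q) × (Fin (l + 1) → Fin M)) : Finset (Fin M → Fin n → Fin q) :=
    Finset.univ.filter fun E => Function.Injective p.2 ∧
      ∀ i, (List.ofFn (E (p.2 i))).Sublist (List.ofFn p.1)
  have hA : ∀ p ∈ Finset.univ,
      (A p).card ≤ (n + g).choose n ^ (l + 1) * q ^ (n * (M - (l + 1))) := by
    rintro ⟨z, f⟩ -
    by_cases hf : Function.Injective f
    · have h := card_filter_forall_apply_mem
        (Finset.univ.filter fun v : Fin n → Fin q => (List.ofFn v).Sublist (List.ofFn z)) hf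
      simp only [Finset.mem_filter_univ, Fintype.card_fin, Fintype.card_fun, ← pow_mul] at h
      have hz := card_filter_ofFn_sublist_le n (List.ofFn z)
      rw [List.length_ofFn] at hz
      simp only [A, hf, true_and]
      calc
        _ = _ := by convert h
        _ ≤ _ := by gcongr
    · simp [A, hf]
  refine (Finset.card_le_card (t := Finset.univ.biUnion A) fun E hE => ?_).trans
    ((Finset.card_biUnion_le_card_mul _ _ _ hA).trans_eq ?_)
  · obtain ⟨z, f, h⟩ := (Finset.mem_filter.mp hE).2
    exact Finset.mem_biUnion.mpr
      ⟨(z, f), Finset.mem_univ _, Finset.mem_filter.mpr ⟨Finset.mem_univ _, h⟩⟩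
  · simp [mul_assoc]
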